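/- arXiv:2402.06943 — 2 statements merged into one kernel-verified Lean document; each statement's English description precedes it below -/
import Mathlib

section
/- Let X be a complex Banach space and A : D(A) ⊆ X → X a closed linear operator. Suppose v : [0,2π] → X is continuous, v(t) ∈ D(A) for 0 < t < 2π, v ∈ C¹((0,2π);X), v'(t) = A v(t) for 0 < t < 2π, and v(2π) = v(0). Then for every nonzero integer k the Fourier coefficient c_k = (1/(2π)) ∫₀^{2π} v(t) e^{−ikt} dt belongs to D(A) and satisfies A c_k = ik c_k. -/
open MeasureTheory Real Filter Topology

noncomputable section

/-- `A` maps the subspace `D` linearly into `X`. -/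
def IsLinearOn {X : Type*} [NormedAddCommGroup X] [NormedSpace ℂ X]
    (A : X → X) (D : Submodule ℂ X) : Prop :=
  (∀ x ∈ D, ∀ y ∈ D, A (x + y) = A x + A y) ∧
  ∀ (c : ℂ), ∀ x ∈ D, A (c • x) = c • A x

/-- `A` is a closed operator with domain `D`. -/
def IsClosedOp {X : Type*} [NormedAddCommGroup X] [NormedSpace ℂ X]
    (A : X → X) (D : Submodule ℂ X) : Prop :=
  ∀ (u : ℕ → X) (x y : X), (∀ n, u n ∈ D) →
    Filter.Tendsto u Filter.atTop (nhds x) →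
    Filter.Tendsto (fun n => A (u n)) Filter.atTop (nhds y) →
    x ∈ D ∧ A x = y

/-- `R` is the (bounded, everywhere defined) inverse of `A - i k I`, i.e. `i k` is a
regular point of `A` with resolvent `R`. -/
def IsResolventAt {X : Type*} [NormedAddCommGroup X] [NormedSpace ℂ X]
    (A : X → X) (D : Submodule ℂ X) (k : ℤ) (R : X →L[ℂ] X) : Prop :=
  (∀ g : X, R g ∈ D ∧ A (R g) - (Complex.I * k) • R g = g) ∧
  ∀ x ∈ D, R (A x - (Complex.I * k) • x) = x

/-- `v` is a solution of `dv/dt = A v` on `(0, 2π)` with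
`(1/(2π)) ∫₀^{2π} v(t) dt = f`. -/
def IsSolution {X : Type*} [NormedAddCommGroup X] [NormedSpace ℂ X] [CompleteSpace X]
    (A : X → X) (D : Submodule ℂ X) (f : X) (v : ℝ → X) : Prop :=
  ContinuousOn v (Set.Icc 0 (2*π)) ∧
  (∀ t ∈ Set.Ioo 0 (2*π), v t ∈ D) ∧
  (∀ t ∈ Set.Ioo 0 (2*π), HasDerivAt v (A (v t)) t) ∧
  ContinuousOn (fun t => A (v t)) (Set.Ioo 0 (2*π)) ∧
  (1/(2*π) : ℝ) • (∫ t in (0:ℝ)..(2*π), v t) = f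

/-- `Σ_k = A (A + i k I)⁻¹ (A - i k I)⁻¹` applied to `g`. -/
def SigmaOp {X : Type*} [NormedAddCommGroup X] [NormedSpace ℂ X]
    (A : X → X) (R : ℤ → X →L[ℂ] X) (k : ℕ) (g : X) : X :=
  A (R (-(k:ℤ)) (R (k:ℤ) g))

/-- `Υ_k = k⁻¹ A² (A + i k I)⁻¹ (A - i k I)⁻¹` applied to `g`. -/
def UpsilonOp {X : Type*} [NormedAddCommGroup X] [NormedSpace ℂ X]
    (A : X → X) (R : ℤ → X →L[ℂ] X) (k : ℕ) (g : X) : X :=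
  ((k:ℂ))⁻¹ • A (A (R (-(k:ℤ)) (R (k:ℤ) g)))

/-- The graph of an operator that is linear on `D`, as a submodule of `X × X`. -/
def IsLinearOn.graph {X : Type*} [NormedAddCommGroup X] [NormedSpace ℂ X]
    {A : X → X} {D : Submodule ℂ X} (h : IsLinearOn A D) : Submodule ℂ (X × X) where
  carrier := {p | p.1 ∈ D ∧ A p.1 = p.2}
  add_mem' := by
    rintro p q ⟨hp, hAp⟩ ⟨hq, hAq⟩
    exact ⟨D.add_mem hp hq, (h.1 _ hp _ hq).trans (congrArg₂ _ hAp hAq)⟩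
  zero_mem' := ⟨D.zero_mem, by simpa using h.2 0 0 D.zero_mem⟩
  smul_mem' := by
    rintro c p ⟨hp, hAp⟩
    exact ⟨D.smul_mem c hp, (h.2 c _ hp).trans (congrArg _ hAp)⟩

theorem IsClosedOp.isClosed_graph {X : Type*} [NormedAddCommGroup X] [NormedSpace ℂ X]
    {A : X → X} {D : Submodule ℂ X} (hc : IsClosedOp A D) (h : IsLinearOn A D) :
    IsClosed (h.graph : Set (X × X)) := by
  refine IsSeqClosed.isClosed fun u p hu hp => ?_
  refine hc (fun n => (u n).1) p.1 p.2 (fun n => (hu n).1) (hp.fst_nhds) ?_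
  simpa only [(hu _).2] using hp.snd_nhds

/-- If `(w t, c • w t + w' t)` stays in a closed subspace `G` and `w` takes the same value at the
endpoints, then `(∫ w, c • ∫ w)` lies in `G`. Passing to the quotient by `G` makes the derivative
continuous, so no integrability of `w'` is needed. -/
theorem integral_mem_of_hasDerivAt {X : Type*} [NormedAddCommGroup X] [NormedSpace ℂ X]
    [CompleteSpace X] {G : Submodule ℂ (X × X)} (hG : IsClosed (G : Set (X × X)))
    {a b : ℝ} (hab : a ≤ b) {w w' : ℝ → X} (c : ℂ) (hw : ContinuousOn w (Set.Icc a b))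
    (hderiv : ∀ t ∈ Set.Ioo a b, HasDerivAt w (w' t) t)
    (hmem : ∀ t ∈ Set.Ioo a b, (w t, c • w t + w' t) ∈ G) (hper : w b = w a) :
    (∫ t in a..b, w t, c • ∫ t in a..b, w t) ∈ G := by
  have : IsClosed (G : Set (X × X)) := hG
  let q : X × X →L[ℂ] (X × X) ⧸ G := G.mkQL
  have hq (p : X × X) : q p = 0 ↔ p ∈ G := Submodule.Quotient.mk_eq_zero G
  let Q : X →L[ℂ] (X × X) ⧸ G := q.comp (.prod (.id ℂ X) (c • .id ℂ X))
  let P : X →L[ℂ] (X × X) ⧸ G := q.comp (.inr ℂ X X)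
  have hP : ∀ t ∈ Set.Ioo a b, HasDerivAt (fun s => P (w s)) (-Q (w t)) t := by
    intro t ht
    have hd : P (w' t) = -Q (w t) := by
      rw [eq_neg_iff_add_eq_zero, ← (hq _).2 (hmem t ht)]
      simp only [P, Q, ContinuousLinearMap.comp_apply, ← map_add]
      simp [add_comm]
    rw [← hd]
    exact (P.restrictScalars ℝ).hasFDerivAt.comp_hasDerivAt t (hderiv t ht)
  have hint : IntervalIntegrable w volume a b := hw.intervalIntegrable_of_Icc hab
  have hQw : ContinuousOn (fun t => Q (w t)) (Set.Icc a b) := Q.continuous.comp_continuousOn hw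
  have hFTC := intervalIntegral.integral_eq_sub_of_hasDerivAt_of_le hab
    (P.continuous.comp_continuousOn hw) hP (hQw.neg.intervalIntegrable_of_Icc hab)
  rw [Function.comp_apply, Function.comp_apply, hper, sub_self, intervalIntegral.integral_neg,
    neg_eq_zero, Q.intervalIntegral_comp_comm hint] at hFTC
  exact (hq _).1 hFTC

theorem fourier_coefficients_are_eigenvectors
    {X : Type*} [NormedAddCommGroup X] [NormedSpace ℂ X] [CompleteSpace X]
    (A : X → X) (D : Submodule ℂ X)
    (hlin : IsLinearOn A D) (hclosed : IsClosedOp A D)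
    (v : ℝ → X)
    (hv_cont : ContinuousOn v (Set.Icc 0 (2*π)))
    (hv_mem : ∀ t ∈ Set.Ioo 0 (2*π), v t ∈ D)
    (hv_deriv : ∀ t ∈ Set.Ioo 0 (2*π), HasDerivAt v (A (v t)) t)
    (hper : v (2*π) = v 0) :
    ∀ k : ℤ, k ≠ 0 →
      (1/(2*π) : ℝ) • (∫ t in (0:ℝ)..(2*π),
          Complex.exp (-(Complex.I * k * t)) • v t) ∈ D ∧
      A ((1/(2*π) : ℝ) • (∫ t in (0:ℝ)..(2*π),
          Complex.exp (-(Complex.I * k * t)) • v t)) =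
        (Complex.I * k) • ((1/(2*π) : ℝ) • (∫ t in (0:ℝ)..(2*π),
          Complex.exp (-(Complex.I * k * t)) • v t)) := by
  intro k _
  set e : ℝ → ℂ := fun t => Complex.exp (-(Complex.I * k * t)) with he
  have hde (t : ℝ) : HasDerivAt e (e t * -(Complex.I * k)) t := by
    simpa using ((((hasDerivAt_id t).ofReal_comp).const_mul (Complex.I * k)).neg).cexp
  have hcont : Continuous e := by fun_prop
  have hper_e : e (2 * π) = e 0 := by
    simp only [he, Complex.ofReal_zero, mul_zero, neg_zero, Complex.exp_zero]
    exact Complex.exp_eq_one_iff.2 ⟨-k, by push_cast; ring⟩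
  have hmem := integral_mem_of_hasDerivAt (hclosed.isClosed_graph hlin) two_pi_pos.le
    (Complex.I * k) (hcont.continuousOn.smul hv_cont)
    (fun t ht => (hde t).smul (hv_deriv t ht)) (fun t ht => ?_) (by simp [hper_e, hper])
  · have h := hlin.graph.smul_mem ((1 / (2 * π) : ℝ) : ℂ) hmem
    rw [Prod.smul_mk, smul_comm _ (Complex.I * k), Complex.coe_smul] at h
    exact h
  · have h := hlin.graph.smul_mem (e t) (show (v t, A (v t)) ∈ hlin.graph from ⟨hv_mem t ht, rfl⟩)
    convert h using 1
    refine Prod.ext rfl ?_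
    simp only [Pi.smul_apply', Prod.smul_mk]
    module
end
end

section
/- Let X be a complex Banach space and A : D(A) ⊆ X → X a closed linear operator such that ik and −ik are regular points of A for all integers k ≥ 1, with ‖(A − ikI)^{-1}‖ ≤ C/|k| for all nonzero integers k and some constant C > 0. Then lim_{n→∞} Σ_n = 0 and lim_{n→∞} Υ_n = 0 in operator norm, where Σ_n = A(A + inI)^{-1}(A − inI)^{-1} and Υ_n = n^{-1} A² (A + inI)^{-1}(A − inI)^{-1}. -/
open MeasureTheory Real Filter Topology

noncomputable section

/-- `V_k = (A² + k² I)⁻¹ = (A + i k I)⁻¹ (A - i k I)⁻¹` applied to `g`. -/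
def VOp {X : Type*} [NormedAddCommGroup X] [NormedSpace ℂ X]
    (R : ℤ → X →L[ℂ] X) (k : ℕ) (g : X) : X :=
  R (-(k:ℤ)) (R (k:ℤ) g)

section ResolventBounds

variable {X : Type*} [NormedAddCommGroup X] [NormedSpace ℂ X]
  {A : X → X} {D : Submodule ℂ X} {R : ℤ → X →L[ℂ] X} {C : ℝ}

theorem IsResolventAt.apply_eq {k : ℤ} {T : X →L[ℂ] X} (h : IsResolventAt A D k T) (g : X) :
    A (T g) = g + (Complex.I * k) • T g :=
  sub_eq_iff_eq_add.1 (h.1 g).2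

theorem apply_VOp (hres : ∀ k : ℤ, k ≠ 0 → IsResolventAt A D k (R k)) {n : ℕ} (hn : 1 ≤ n)
    (g : X) : A (VOp R n g) = R n g + (-(Complex.I * n)) • VOp R n g := by
  have h := (hres (-(n : ℤ)) (by omega)).apply_eq (R n g)
  simpa only [VOp, Int.cast_neg, Int.cast_natCast, mul_neg] using h

theorem apply_apply_VOp (hlin : IsLinearOn A D)
    (hres : ∀ k : ℤ, k ≠ 0 → IsResolventAt A D k (R k)) {n : ℕ} (hn : 1 ≤ n) (g : X) :
    A (A (VOp R n g)) = g - ((n : ℂ) ^ 2) • VOp R n g := by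
  have hD : R n g ∈ D := ((hres n (by omega)).1 g).1
  have hV : VOp R n g ∈ D := ((hres (-(n : ℤ)) (by omega)).1 (R n g)).1
  have hR := (hres n (by omega)).apply_eq g
  have hI : Complex.I ^ 2 = -1 := Complex.I_sq
  rw [apply_VOp hres hn g, hlin.1 _ hD _ (D.smul_mem _ hV), hlin.2 _ _ hV, apply_VOp hres hn g,
    hR, Int.cast_natCast]
  match_scalars
  · ring
  · ring
  · linear_combination (n : ℂ) ^ 2 * hI

theorem norm_resolvent_apply_le (hbound : ∀ k : ℤ, k ≠ 0 → ‖R k‖ ≤ C / |(k : ℝ)|) {k : ℤ}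
    (hk : k ≠ 0) (g : X) : ‖R k g‖ ≤ C / |(k : ℝ)| * ‖g‖ :=
  (R k).le_of_opNorm_le (hbound k hk) g

theorem norm_VOp_le (hC : 0 < C) (hbound : ∀ k : ℤ, k ≠ 0 → ‖R k‖ ≤ C / |(k : ℝ)|) {n : ℕ}
    (hn : 1 ≤ n) (g : X) : ‖VOp R n g‖ ≤ C ^ 2 / n ^ 2 * ‖g‖ := by
  have h₁ := norm_resolvent_apply_le hbound (k := -(n : ℤ)) (by omega) (R n g)
  have h₂ := norm_resolvent_apply_le hbound (k := n) (by omega) g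
  simp only [Int.cast_neg, Int.cast_natCast, abs_neg, Nat.abs_cast] at h₁ h₂
  calc ‖VOp R n g‖ ≤ C / n * ‖R n g‖ := h₁
    _ ≤ C / n * (C / n * ‖g‖) := by gcongr
    _ = C ^ 2 / n ^ 2 * ‖g‖ := by ring

theorem norm_apply_VOp_le (hC : 0 < C) (hres : ∀ k : ℤ, k ≠ 0 → IsResolventAt A D k (R k))
    (hbound : ∀ k : ℤ, k ≠ 0 → ‖R k‖ ≤ C / |(k : ℝ)|) {n : ℕ} (hn : 1 ≤ n) (g : X) :
    ‖A (VOp R n g)‖ ≤ (C + C ^ 2) / n * ‖g‖ := by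
  have hn0 : (n : ℝ) ≠ 0 := by positivity
  have h := norm_resolvent_apply_le hbound (k := n) (by omega) g
  simp only [Int.cast_natCast, Nat.abs_cast] at h
  rw [apply_VOp hres hn g]
  calc ‖R n g + (-(Complex.I * n)) • VOp R n g‖
      ≤ ‖R n g‖ + ‖(-(Complex.I * n)) • VOp R n g‖ := norm_add_le _ _
    _ = ‖R n g‖ + n * ‖VOp R n g‖ := by simp [norm_smul]
    _ ≤ C / n * ‖g‖ + n * (C ^ 2 / n ^ 2 * ‖g‖) := by
      gcongr
      exact norm_VOp_le hC hbound hn g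
    _ = (C + C ^ 2) / n * ‖g‖ := by field_simp

theorem norm_apply_apply_VOp_le (hC : 0 < C) (hlin : IsLinearOn A D)
    (hres : ∀ k : ℤ, k ≠ 0 → IsResolventAt A D k (R k))
    (hbound : ∀ k : ℤ, k ≠ 0 → ‖R k‖ ≤ C / |(k : ℝ)|) {n : ℕ} (hn : 1 ≤ n) (g : X) :
    ‖A (A (VOp R n g))‖ ≤ (1 + C ^ 2) * ‖g‖ := by
  have hn0 : (n : ℝ) ≠ 0 := by positivity
  rw [apply_apply_VOp hlin hres hn g]
  calc ‖g - ((n : ℂ) ^ 2) • VOp R n g‖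
      ≤ ‖g‖ + ‖((n : ℂ) ^ 2) • VOp R n g‖ := norm_sub_le _ _
    _ = ‖g‖ + n ^ 2 * ‖VOp R n g‖ := by simp [norm_smul]
    _ ≤ ‖g‖ + n ^ 2 * (C ^ 2 / n ^ 2 * ‖g‖) := by
      gcongr
      exact norm_VOp_le hC hbound hn g
    _ = (1 + C ^ 2) * ‖g‖ := by field_simp

theorem tendsto_norm_zero_of_apply_le_div {T : ℕ → X →L[ℂ] X} {K : ℝ} (hK : 0 ≤ K)
    (h : ∀ n : ℕ, 1 ≤ n → ∀ g : X, ‖T n g‖ ≤ K / n * ‖g‖) :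
    Tendsto (fun n => ‖T n‖) atTop (𝓝 0) := by
  refine squeeze_zero' (.of_forall fun n => norm_nonneg _) ?_
    (tendsto_const_div_atTop_nhds_zero_nat K)
  filter_upwards [eventually_ge_atTop 1] with n hn
  exact (T n).opNorm_le_bound (by positivity) (h n hn)

end ResolventBounds

theorem sigma_upsilon_tend_to_zero
    {X : Type*} [NormedAddCommGroup X] [NormedSpace ℂ X] [CompleteSpace X]
    (A : X → X) (D : Submodule ℂ X) (R : ℤ → X →L[ℂ] X) (C : ℝ) (hC : 0 < C)
    (hlin : IsLinearOn A D) (hclosed : IsClosedOp A D)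
    (hres : ∀ k : ℤ, k ≠ 0 → IsResolventAt A D k (R k))
    (hbound : ∀ k : ℤ, k ≠ 0 → ‖R k‖ ≤ C / |(k:ℝ)|)
    (S U : ℕ → X →L[ℂ] X)
    (hS : ∀ n : ℕ, 1 ≤ n → ∀ g : X, S n g = A (VOp R n g))
    (hU : ∀ n : ℕ, 1 ≤ n → ∀ g : X, U n g = ((n:ℂ))⁻¹ • A (A (VOp R n g))) :
    Filter.Tendsto (fun n => ‖S n‖) Filter.atTop (nhds 0) ∧
    Filter.Tendsto (fun n => ‖U n‖) Filter.atTop (nhds 0) := by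
  refine ⟨tendsto_norm_zero_of_apply_le_div (K := C + C ^ 2) (by positivity) fun n hn g => ?_,
    tendsto_norm_zero_of_apply_le_div (K := 1 + C ^ 2) (by positivity) fun n hn g => ?_⟩
  · rw [hS n hn g]
    exact norm_apply_VOp_le hC hres hbound hn g
  · rw [hU n hn g, norm_smul, norm_inv, Complex.norm_natCast, div_eq_inv_mul, mul_assoc]
    gcongr
    exact norm_apply_apply_VOp_le hC hlin hres hbound hn g
end
end
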